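/- Let V be a finite-dimensional real vector space with a Lorentzian symmetric bilinear form B, and let ρ : sl(2,ℝ) → End(V) be a Lie algebra homomorphism whose image consists of endomorphisms skew-adjoint with respect to B. If W ⊆ V is an sl(2,ℝ)-invariant subspace of dimension at least 2 on which the induced representation is irreducible and faithful, then the restriction of B to W is nondegenerate of signature (1, dim W − 1), i.e. Lorentzian. -/

import Mathlib

open Module

attribute [local instance 100] LieRing.ofAssociativeRing

/-- A symmetric bilinear form on a finite-dimensional real vector space is *Lorentzian* if
some basis puts it in the form `diag(-1, 1, …, 1)`. -/
def IsLorentzian {V : Type*} [AddCommGroup V] [Module ℝ V]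
    (B : LinearMap.BilinForm ℝ V) : Prop :=
  ∃ b : Basis (Fin (finrank ℝ V)) ℝ V,
    ∀ i j, B (b i) (b j) = if i = j then (if (i : ℕ) = 0 then (-1 : ℝ) else 1) else 0


/-- In a Lorentzian space there is a functional whose kernel is positive definite. -/
theorem lorentz_functional {V : Type*} [AddCommGroup V] [Module ℝ V]
    (hdim : 2 ≤ finrank ℝ V) (B : LinearMap.BilinForm ℝ V) (hB : IsLorentzian B) :
    ∃ φ : V →ₗ[ℝ] ℝ, ∀ z, φ z = 0 → B z z ≤ 0 → z = 0 := by
  obtain ⟨b, hb⟩ := hB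
  let i0 : Fin (finrank ℝ V) := ⟨0, by omega⟩
  refine ⟨b.coord i0, fun z hz hle => ?_⟩
  have hz0 : b.repr z i0 = 0 := hz
  have h1 : B z z = ∑ i, (b.repr z i) ^ 2 := by
    rw [← LinearMap.BilinForm.sum_repr_mul_repr_mul b z z]
    rw [Finsupp.sum_fintype _ _ (by simp)]
    refine Finset.sum_congr rfl fun i _ => ?_
    rw [Finsupp.sum_fintype _ _ (by simp), Finset.sum_eq_single i]
    · rw [hb]
      by_cases h : (i : ℕ) = 0
      · have : i = i0 := Fin.ext h
        subst this
        simp [hz0]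
      · simp [h, sq]
    · intro j _ hj
      rw [hb]
      simp [Ne.symm hj]
    · simp
  rw [h1] at hle
  have h2 := (Finset.sum_eq_zero_iff_of_nonneg (fun i _ => sq_nonneg (b.repr z i))).1
    (le_antisymm hle (Finset.sum_nonneg fun i _ => sq_nonneg _))
  apply b.ext_elem
  intro i
  simpa using h2 i (Finset.mem_univ i)

/-- A skew endomorphism `E` of a definite space with `[H, E] = 2 E` vanishes. -/
theorem skew_eq_zero {W : Type*} [AddCommGroup W] [Module ℝ W] {n : ℕ}
    (C : LinearMap.BilinForm ℝ W) (v : Basis (Fin n) ℝ W)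
    (hv : ∀ i j, i ≠ j → C (v i) (v j) = 0) (hpos : ∀ i, 0 < C (v i) (v i))
    (E H : Module.End ℝ W) (hE : ∀ u w, C (E u) w + C u (E w) = 0)
    (hHE : H * E - E * H = (2 : ℝ) • E) : E = 0 := by
  have hdiag : ∀ i w, C (v i) w = v.repr w i * C (v i) (v i) := by
    intro i w
    conv_lhs => rw [← v.sum_repr w]
    rw [map_sum, Finset.sum_eq_single i]
    · simp
    · intro j _ hj
      simp [hv i j hj.symm]
    · simp
  have hsq : ∀ w, C w w = ∑ i, (v.repr w i) ^ 2 * C (v i) (v i) := by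
    intro w
    conv_lhs => 
      arg 1
      rw [← v.sum_repr w]
    rw [map_sum, LinearMap.sum_apply]
    refine Finset.sum_congr rfl fun i _ => ?_
    rw [map_smul, LinearMap.smul_apply, hdiag, smul_eq_mul]
    ring
  have hnn : ∀ w, 0 ≤ C w w := fun w => by
    rw [hsq]
    exact Finset.sum_nonneg fun i _ => mul_nonneg (sq_nonneg _) (hpos i).le
  have hdef : ∀ w, C w w = 0 → w = 0 := by
    intro w hw
    rw [hsq] at hw
    have h2 := (Finset.sum_eq_zero_iff_of_nonneg
      (fun i _ => mul_nonneg (sq_nonneg (v.repr w i)) (hpos i).le)).1 hw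
    apply v.ext_elem
    intro i
    have := h2 i (Finset.mem_univ i)
    simpa [(hpos i).ne'] using this
  have htr : LinearMap.trace ℝ W (E * E) = 0 := by
    have h1 : LinearMap.trace ℝ W ((H * E - E * H) * E) = 0 := by
      rw [sub_mul, map_sub, LinearMap.trace_mul_comm ℝ (E * H) E, mul_assoc,
        LinearMap.trace_mul_comm ℝ H (E * E), mul_assoc, sub_self]
    rw [hHE] at h1
    simpa using h1
  rw [LinearMap.trace_eq_matrix_trace ℝ v, Matrix.trace] at htr
  have hent : ∀ i, (LinearMap.toMatrix v v (E * E)).diag i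
      = -(C (E (v i)) (E (v i)) / C (v i) (v i)) := by
    intro i
    rw [Matrix.diag_apply, LinearMap.toMatrix_apply, Module.End.mul_apply]
    have h1 := hdiag i (E (E (v i)))
    have h2 := hE (v i) (E (v i))
    have h3 := (hpos i).ne'
    field_simp
    linarith
  simp only [hent, Finset.sum_neg_distrib, neg_eq_zero] at htr
  have h2 := (Finset.sum_eq_zero_iff_of_nonneg
      (fun i _ => div_nonneg (hnn (E (v i))) (hpos i).le)).1 htr
  apply v.ext
  intro i
  have h3 := h2 i (Finset.mem_univ i)
  rw [div_eq_zero_iff, or_iff_left (hpos i).ne'] at h3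
  simpa using hdef _ h3

/-- Let `ρ : sl(2,ℝ) → End(V)` be a Lie algebra homomorphism with `B`-skew-adjoint image,
where `B` is a Lorentzian symmetric bilinear form on `V`.  If `W` is an invariant subspace
of dimension at least `2` on which the induced representation is irreducible and faithful,
then the restriction of `B` to `W` is nondegenerate of signature `(1, dim W - 1)`,
i.e. Lorentzian. -/
theorem invariant_irreducible_faithful_subspace_is_lorentzian {V : Type*} [AddCommGroup V]
    [Module ℝ V] [FiniteDimensional ℝ V] (hdim : 2 ≤ finrank ℝ V)
    (B : LinearMap.BilinForm ℝ V) (hsymm : B.IsSymm) (hB : IsLorentzian B)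
    (ρ : LieAlgebra.SpecialLinear.sl (Fin 2) ℝ →ₗ⁅ℝ⁆ Module.End ℝ V)
    (hskew : ∀ A : LieAlgebra.SpecialLinear.sl (Fin 2) ℝ, ∀ u v : V,
      B (ρ A u) v + B u (ρ A v) = 0)
    (W : Submodule ℝ V)
    (hinv : ∀ A : LieAlgebra.SpecialLinear.sl (Fin 2) ℝ, ∀ w ∈ W, ρ A w ∈ W)
    (hWdim : 2 ≤ finrank ℝ W)
    (hirr : ∀ U : Submodule ℝ V, U ≤ W →
      (∀ A : LieAlgebra.SpecialLinear.sl (Fin 2) ℝ, ∀ u ∈ U, ρ A u ∈ U) → U = ⊥ ∨ U = W)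
    (hfaith : ∀ A : LieAlgebra.SpecialLinear.sl (Fin 2) ℝ,
      (∀ w ∈ W, ρ A w = 0) → A = 0) :
    ∃ b : Basis (Fin (finrank ℝ W)) ℝ W,
      ∀ i j, B (b i : V) (b j : V)
        = if i = j then (if (i : ℕ) = 0 then (-1 : ℝ) else 1) else 0 := by
  classical
  obtain ⟨φ, hφ⟩ := lorentz_functional hdim B hB
  let C : LinearMap.BilinForm ℝ W := B.restrict W
  have hC : ∀ x y : W, C x y = B x y := fun _ _ => rfl
  have hCs : LinearMap.IsSymm C := ⟨fun x y => hsymm.eq (x : V) (y : V)⟩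
  obtain ⟨v, hv⟩ := LinearMap.BilinForm.exists_orthogonal_basis hCs
  have hort : ∀ i j, i ≠ j → C (v i) (v j) = 0 := fun i j hij => hv hij
  -- at most one nonpositive diagonal entry
  have hone : ∀ i j, i ≠ j → C (v i) (v i) ≤ 0 → C (v j) (v j) ≤ 0 → False := by
    intro i j hij hi hj
    have hli := v.linearIndependent
    have hz : φ (v j) • v i - φ (v i) • v j = 0 := by
      apply Subtype.ext
      apply hφ
      · simp [mul_comm]
      · change C (φ (v j) • v i - φ (v i) • v j) (φ (v j) • v i - φ (v i) • v j) ≤ 0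
        simp only [map_sub, map_smul, LinearMap.sub_apply, LinearMap.smul_apply, smul_eq_mul,
          hort i j hij, hort j i hij.symm]
        nlinarith [mul_nonneg (sq_nonneg (φ (v j))) (neg_nonneg.2 hi),
          mul_nonneg (sq_nonneg (φ (v i))) (neg_nonneg.2 hj)]
    have h0 : φ (v i) = 0 := by
      have := congrArg (fun w => v.repr w j) hz
      simpa [hij] using this
    have h1 : v i = 0 := Subtype.ext (hφ _ h0 hi)
    exact v.ne_zero i h1
  -- the radical
  have hne : ∀ i, C (v i) (v i) ≠ 0 := by
    intro i hi
    let R : Submodule ℝ V := W ⊓ (⨅ w : W, LinearMap.ker (B (w : V)))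
    have hR : ∀ x, x ∈ R ↔ x ∈ W ∧ ∀ w ∈ W, B w x = 0 := by
      intro x
      simp [R, Submodule.mem_iInf]
    have hmem : (v i : V) ∈ R := by
      rw [hR]
      refine ⟨(v i).2, fun w hw => ?_⟩
      have h0 : (LinearMap.flip C (v i)) = 0 := by
        apply v.ext
        intro j
        by_cases hji : j = i
        · subst hji
          simpa using hi
        · simpa using hort j i hji
      exact LinearMap.congr_fun h0 ⟨w, hw⟩
    rcases hirr R inf_le_left (by
      intro A u hu
      rw [hR] at hu ⊢
      refine ⟨hinv A u hu.1, fun w hw => ?_⟩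
      have h1 := hskew A w u
      have h2 := hu.2 _ (hinv A w hw)
      linarith) with h | h
    · rw [h, Submodule.mem_bot] at hmem
      exact v.ne_zero i (Subtype.ext hmem)
    · have : Nontrivial (Fin (finrank ℝ W)) := Fin.nontrivial_iff_two_le.2 hWdim
      obtain ⟨j, hj⟩ := exists_ne i
      refine hone j i hj ?_ hi.le
      have hjm : (v j : V) ∈ R := h.ge (v j).2
      exact (((hR _).1 hjm).2 _ (v j).2).le
  -- some negative entry
  have hneg : ∃ k, C (v k) (v k) < 0 := by
    by_contra hcon
    have hpos : ∀ i, 0 < C (v i) (v i) := fun i =>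
      lt_of_le_of_ne (not_lt.1 fun hl => hcon ⟨i, hl⟩) (hne i).symm
    let e : LieAlgebra.SpecialLinear.sl (Fin 2) ℝ := ⟨!![0, 1; 0, 0], by
      simp [LieAlgebra.SpecialLinear.sl, Matrix.trace]⟩
    let hh : LieAlgebra.SpecialLinear.sl (Fin 2) ℝ := ⟨!![1, 0; 0, -1], by
      simp [LieAlgebra.SpecialLinear.sl, Matrix.trace]⟩
    have hhe : ⁅hh, e⁆ = (2 : ℝ) • e := by
      apply Subtype.ext
      change (!![1, 0; 0, -1] : Matrix (Fin 2) (Fin 2) ℝ) * !![0, 1; 0, 0]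
        - !![0, 1; 0, 0] * !![1, 0; 0, -1] = (2 : ℝ) • !![0, 1; 0, 0]
      ext i j
      fin_cases i <;> fin_cases j <;> norm_num
    have hρ : ρ hh * ρ e - ρ e * ρ hh = (2 : ℝ) • ρ e := by
      rw [← map_smul, ← hhe, LieHom.map_lie]
      rfl
    have hE := skew_eq_zero C v hort hpos ((ρ e).restrict (hinv e)) ((ρ hh).restrict (hinv hh))
      (fun u w => hskew e u w) (by
        ext w
        exact LinearMap.congr_fun hρ (w : V))
    have he : e = 0 := hfaith e fun w hw =>
      congrArg Subtype.val (LinearMap.congr_fun hE ⟨w, hw⟩)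
    have h01 := congrArg (fun M : LieAlgebra.SpecialLinear.sl (Fin 2) ℝ => M.1 0 1) he
    simp [e] at h01
  obtain ⟨k, hk⟩ := hneg
  have hpos : ∀ i, i ≠ k → 0 < C (v i) (v i) := fun i hi => by
    by_contra! hcon
    exact hone i k hi hcon hk.le
  let i0 : Fin (finrank ℝ W) := ⟨0, by omega⟩
  let s : Fin (finrank ℝ W) → ℝ := fun i => (Real.sqrt |C (v i) (v i)|)⁻¹
  have hs0 : ∀ i, s i ≠ 0 := fun i =>
    inv_ne_zero (Real.sqrt_ne_zero'.2 (abs_pos.2 (hne i)))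
  have hs : ∀ i, s i * s i = |C (v i) (v i)|⁻¹ := fun i => by
    simp only [s]
    rw [← mul_inv, Real.mul_self_sqrt (abs_nonneg _)]
  let v' := v.unitsSMul (fun i => Units.mk0 (s i) (hs0 i))
  have hv' : ∀ i, v' i = s i • v i := fun i => by
    simp only [v', Basis.unitsSMul_apply]
    rfl
  refine ⟨v'.reindex (Equiv.swap k i0), fun i j => ?_⟩
  rw [← hC]
  simp only [Basis.reindex_apply, Equiv.symm_swap, hv', map_smul, LinearMap.smul_apply, smul_eq_mul]
  by_cases hij : i = j
  · subst hij
    have key : ∀ l, s l * (s l * C (v l) (v l)) = if l = k then -1 else 1 := by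
      intro l
      rw [← mul_assoc, hs]
      split_ifs with hl
      · subst hl
        rw [abs_of_neg hk]
        field_simp [hne l]
      · rw [abs_of_pos (hpos l hl)]
        exact inv_mul_cancel₀ (hne l)
    rw [key, if_pos rfl]
    have : (Equiv.swap k i0 i = k) ↔ (i : ℕ) = 0 := by
      rw [Equiv.swap_apply_eq_iff, Equiv.swap_apply_left]
      exact Fin.ext_iff
    simp [this]
  · rw [if_neg hij, hort _ _ (fun h => hij ((Equiv.swap k i0).injective h))]
    simp
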